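/- Let α > 0 and β > 0 be real, a ∈ ℤ, f : ℤ → ℝ, and t ∈ ℤ with t ≥ a. Then (∇_a^{−α}(∇_a^{−β} f))(t) = (∇_a^{−(α+β)} f)(t); in particular nabla left fractional sums commute: (∇_a^{−α}(∇_a^{−β} f))(t) = (∇_a^{−β}(∇_a^{−α} f))(t). -/

import Mathlib

/-- Backward difference operator: `(∇ f)(t) = f t − f (t−1)`. -/
def nablaOp (f : ℤ → ℝ) : ℤ → ℝ := fun t => f t - f (t - 1)

/-- Forward difference operator: `(Δ f)(t) = f (t+1) − f t`. -/
def deltaOp (f : ℤ → ℝ) : ℤ → ℝ := fun t => f (t + 1) - f t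

/-- The operator `−Δ`. -/
def negDeltaOp (f : ℤ → ℝ) : ℤ → ℝ := fun t => -(f (t + 1) - f t)

/-- Nabla left fractional sum of order `α` starting at `a`:
`(∇_a^{-α} f)(t) = (1/Γ(α)) Σ_{s=a+1}^{t} [Γ(t−s+α)/Γ(t−s+1)] f(s)`. -/
noncomputable def nablaLeftSum (a : ℤ) (α : ℝ) (f : ℤ → ℝ) : ℤ → ℝ := fun t =>
  (1 / Real.Gamma α) * ∑ s ∈ Finset.Icc (a + 1) t,
    (Real.Gamma ((t : ℝ) - (s : ℝ) + α) / Real.Gamma ((t : ℝ) - (s : ℝ) + 1)) * f s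

/-- Nabla right fractional sum of order `α` ending at `b`:
`(_b∇^{-α} f)(t) = (1/Γ(α)) Σ_{s=t}^{b−1} [Γ(s−t+α)/Γ(s−t+1)] f(s)`. -/
noncomputable def nablaRightSum (b : ℤ) (α : ℝ) (f : ℤ → ℝ) : ℤ → ℝ := fun t =>
  (1 / Real.Gamma α) * ∑ s ∈ Finset.Icc t (b - 1),
    (Real.Gamma ((s : ℝ) - (t : ℝ) + α) / Real.Gamma ((s : ℝ) - (t : ℝ) + 1)) * f s

/-- The rising factorial quotient `Γ(n + α) / (Γ(α) n!)`, the kernel of the nabla left fractional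
sum of order `α`. -/
noncomputable def nablaKernel (α : ℝ) (n : ℕ) : ℝ :=
  Real.Gamma (n + α) / (Real.Gamma α * n.factorial)

theorem nablaKernel_zero {α : ℝ} (hα : 0 < α) : nablaKernel α 0 = 1 := by
  simp [nablaKernel, (Real.Gamma_pos_of_pos hα).ne']

theorem nablaKernel_succ {α : ℝ} (hα : 0 < α) (n : ℕ) :
    ((n : ℝ) + 1) * nablaKernel α (n + 1) = (n + α) * nablaKernel α n := by
  have h₁ : Real.Gamma α ≠ 0 := (Real.Gamma_pos_of_pos hα).ne'
  have h₂ : (n.factorial : ℝ) ≠ 0 := by positivity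
  have h₃ : (n : ℝ) + 1 ≠ 0 := by positivity
  have h₄ : Real.Gamma ((n : ℝ) + 1 + α) = (n + α) * Real.Gamma (n + α) := by
    rw [← Real.Gamma_add_one (by positivity)]
    ring_nf
  simp only [nablaKernel, Nat.factorial_succ]
  push_cast
  rw [h₄]
  field_simp

/-- Chu–Vandermonde convolution identity for the kernels of nabla fractional sums. -/
theorem sum_antidiagonal_nablaKernel {α β : ℝ} (hα : 0 < α) (hβ : 0 < β) (n : ℕ) :
    ∑ p ∈ Finset.HasAntidiagonal.antidiagonal n, nablaKernel α p.1 * nablaKernel β p.2 =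
      nablaKernel (α + β) n := by
  induction n with
  | zero => simp [nablaKernel_zero, hα, hβ, add_pos hα hβ]
  | succ n ih =>
    have hn : (n : ℝ) + 1 ≠ 0 := by positivity
    apply mul_left_cancel₀ hn
    rw [nablaKernel_succ (add_pos hα hβ), ← ih]
    have h₁ : ∑ p ∈ Finset.HasAntidiagonal.antidiagonal (n + 1),
        (p.1 : ℝ) * (nablaKernel α p.1 * nablaKernel β p.2) =
        ∑ p ∈ Finset.HasAntidiagonal.antidiagonal n,
          (p.1 + α) * (nablaKernel α p.1 * nablaKernel β p.2) := by
      rw [Finset.Nat.sum_antidiagonal_succ]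
      simp only [Nat.cast_zero, zero_mul, zero_add, Nat.cast_succ]
      refine Finset.sum_congr rfl fun p _ => ?_
      rw [← mul_assoc, nablaKernel_succ hα, mul_assoc]
    have h₂ : ∑ p ∈ Finset.HasAntidiagonal.antidiagonal (n + 1),
        (p.2 : ℝ) * (nablaKernel α p.1 * nablaKernel β p.2) =
        ∑ p ∈ Finset.HasAntidiagonal.antidiagonal n,
          (p.2 + β) * (nablaKernel α p.1 * nablaKernel β p.2) := by
      rw [Finset.Nat.sum_antidiagonal_succ']
      simp only [Nat.cast_zero, zero_mul, zero_add, Nat.cast_succ]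
      refine Finset.sum_congr rfl fun p _ => ?_
      rw [mul_left_comm, nablaKernel_succ hβ, mul_left_comm]
    calc _ = ∑ p ∈ Finset.HasAntidiagonal.antidiagonal (n + 1),
          ((p.1 : ℝ) * (nablaKernel α p.1 * nablaKernel β p.2) +
            (p.2 : ℝ) * (nablaKernel α p.1 * nablaKernel β p.2)) := by
          rw [Finset.mul_sum]
          refine Finset.sum_congr rfl fun p hp => ?_
          have hp' : (p.1 : ℝ) + p.2 = n + 1 := by
            exact_mod_cast Finset.HasAntidiagonal.mem_antidiagonal.mp hp
          rw [← add_mul, hp']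
      _ = _ := by
          rw [Finset.sum_add_distrib, h₁, h₂, ← Finset.sum_add_distrib, Finset.mul_sum]
          refine Finset.sum_congr rfl fun p hp => ?_
          have hp' : (p.1 : ℝ) + p.2 = n := by
            exact_mod_cast Finset.HasAntidiagonal.mem_antidiagonal.mp hp
          rw [← hp']
          ring

theorem nablaLeftSum_eq_sum_nablaKernel (a : ℤ) (α : ℝ) (f : ℤ → ℝ) (t : ℤ) :
    nablaLeftSum a α f t =
      ∑ s ∈ Finset.Icc (a + 1) t, nablaKernel α (t - s).toNat * f s := by
  rw [nablaLeftSum, Finset.mul_sum]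
  refine Finset.sum_congr rfl fun s hs => ?_
  obtain ⟨n, hn⟩ := Int.eq_ofNat_of_zero_le (sub_nonneg.mpr (Finset.mem_Icc.mp hs).2)
  have hn' : (t : ℝ) - s = n := by exact_mod_cast hn
  rw [hn, hn', Int.toNat_natCast, Real.Gamma_nat_eq_factorial, nablaKernel, ← mul_assoc,
    div_mul_div_comm, one_mul]

theorem sum_Icc_nablaKernel {α β : ℝ} (hα : 0 < α) (hβ : 0 < β) {r t : ℤ} (hrt : r ≤ t) :
    ∑ s ∈ Finset.Icc r t, nablaKernel α (t - s).toNat * nablaKernel β (s - r).toNat =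
      nablaKernel (α + β) (t - r).toNat := by
  rw [← sum_antidiagonal_nablaKernel hα hβ]
  refine Finset.sum_bij' (fun s _ => ((t - s).toNat, (s - r).toNat)) (fun p _ => r + p.2)
    ?_ ?_ ?_ ?_ ?_
  · intro s hs
    simp only [Finset.mem_Icc, Finset.HasAntidiagonal.mem_antidiagonal] at *
    lia
  · intro p hp
    simp only [Finset.mem_Icc, Finset.HasAntidiagonal.mem_antidiagonal] at *
    lia
  · intro s hs
    simp only [Finset.mem_Icc] at *
    lia
  · intro p hp
    simp only [Finset.HasAntidiagonal.mem_antidiagonal] at hp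
    ext <;> dsimp only <;> lia
  · intro s _
    rfl

/-- The semigroup law for nabla left fractional sums. -/
theorem nablaLeftSum_nablaLeftSum {α β : ℝ} (hα : 0 < α) (hβ : 0 < β) (a : ℤ) (f : ℤ → ℝ)
    (t : ℤ) : nablaLeftSum a α (nablaLeftSum a β f) t = nablaLeftSum a (α + β) f t := by
  simp only [nablaLeftSum_eq_sum_nablaKernel, Finset.mul_sum]
  rw [Finset.sum_comm' (t' := Finset.Icc (a + 1) t) (s' := fun r => Finset.Icc r t)]
  · refine Finset.sum_congr rfl fun r hr => ?_
    simp only [← mul_assoc, ← Finset.sum_mul]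
    rw [sum_Icc_nablaKernel hα hβ (Finset.mem_Icc.mp hr).2]
  · intro s r
    simp only [Finset.mem_Icc]
    lia

theorem stmt8 (α β : ℝ) (hα : 0 < α) (hβ : 0 < β) (a : ℤ) (f : ℤ → ℝ) (t : ℤ)
    (ht : a ≤ t) :
    nablaLeftSum a α (nablaLeftSum a β f) t = nablaLeftSum a (α + β) f t ∧
      nablaLeftSum a α (nablaLeftSum a β f) t = nablaLeftSum a β (nablaLeftSum a α f) t := by
  have h := nablaLeftSum_nablaLeftSum hα hβ a f t
  exact ⟨h, by rw [h, nablaLeftSum_nablaLeftSum hβ hα, add_comm]⟩
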